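/- Fix q > 0 and L > 0. There exists a constant C > 0 depending only on L and q such that for all integers m ≥ 1, d ≥ 1 and every ε ∈ (0,1), there exists a finite set N of probability densities on [0,1]^d with log |N| ≤ C · m · d^{1+1/q} · (1/ε)^{2/q} such that for every f ∈ G^{(m,d)}_{F_{L,q}} there is g ∈ N with H(f,g) ≤ ε. -/

import Mathlib

open MeasureTheory
open scoped ENNReal

/-- The unit cube `[0,1]^d`. -/
def unitCube (d : ℕ) : Set (Fin d → ℝ) :=
  Set.univ.pi fun _ => Set.Icc (0 : ℝ) 1

/-- For `q > 0`, the integer part `l` in the decomposition `q = l + β` with `β ∈ (0,1]`. -/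
noncomputable def holderInt (q : ℝ) : ℕ := ⌈q⌉₊ - 1

/-- The class `F_{L,q}` of `q`-Hölder smooth probability densities on `[0,1]`:
nonnegative, integrating to one, `l`-times continuously differentiable on `[0,1]`, with the
`l`-th derivative `β`-Hölder continuous with constant `L`, where `q = l + β`, `β ∈ (0,1]`. -/
noncomputable def HolderClass (L q : ℝ) : Set (ℝ → ℝ) :=
  {f | (∀ x ∈ Set.Icc (0 : ℝ) 1, 0 ≤ f x) ∧
    (∫ x in Set.Icc (0 : ℝ) 1, f x) = 1 ∧
    ContDiffOn ℝ (holderInt q) f (Set.Icc (0 : ℝ) 1) ∧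
    ∀ x ∈ Set.Icc (0 : ℝ) 1, ∀ y ∈ Set.Icc (0 : ℝ) 1,
      |iteratedDerivWithin (holderInt q) f (Set.Icc (0 : ℝ) 1) x -
        iteratedDerivWithin (holderInt q) f (Set.Icc (0 : ℝ) 1) y| ≤
        L * |x - y| ^ (q - holderInt q)}

/-- The class `G^{(m,d)}_{F_{L,q}}` of `m`-component mixtures of products of densities
from `F_{L,q}`. -/
noncomputable def MixtureClass (L q : ℝ) (m d : ℕ) : Set ((Fin d → ℝ) → ℝ) :=
  {g | ∃ (π : Fin m → ℝ) (f : Fin m → Fin d → ℝ → ℝ),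
    (∀ k, 0 ≤ π k) ∧ (∑ k, π k = 1) ∧ (∀ k j, f k j ∈ HolderClass L q) ∧
    g = fun x => ∑ k, π k * ∏ j, f k j (x j)}

/-- The Hellinger distance between densities on `[0,1]^d`. -/
noncomputable def hellingerDist {d : ℕ} (p q : (Fin d → ℝ) → ℝ) : ℝ :=
  Real.sqrt (∫ x in unitCube d, (Real.sqrt (p x) - Real.sqrt (q x)) ^ 2)

/-- The total variation distance between densities on `[0,1]^d`. -/
noncomputable def tvDist {d : ℕ} (p q : (Fin d → ℝ) → ℝ) : ℝ :=
  (1 / 2) * ∫ x in unitCube d, |p x - q x|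

/-- A probability density on the unit cube `[0,1]^d`. -/
def IsDensityOnCube {d : ℕ} (g : (Fin d → ℝ) → ℝ) : Prop :=
  (∀ x ∈ unitCube d, 0 ≤ g x) ∧ (∫ x in unitCube d, g x) = 1

/-- Taylor's formula for a tower `F 0, F 1, …, F l` of successive derivatives on `[0,1]` whose top
member is Hölder continuous of exponent `β`. -/
lemma abs_sub_taylor_le_of_holder {l : ℕ} {F : ℕ → ℝ → ℝ} {β L : ℝ} (hβ : 0 < β) (hL : 0 ≤ L)
    (hF : ∀ j < l, ∀ x ∈ Set.Icc (0 : ℝ) 1,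
      HasDerivWithinAt (F j) (F (j + 1) x) (Set.Icc 0 1) x)
    (hH : ∀ x ∈ Set.Icc (0 : ℝ) 1, ∀ y ∈ Set.Icc (0 : ℝ) 1,
      |F l x - F l y| ≤ L * |x - y| ^ β) (k : ℕ) :
    ∀ j, j + k = l → ∀ x ∈ Set.Icc (0 : ℝ) 1, ∀ y ∈ Set.Icc (0 : ℝ) 1, x ≤ y →
      |F j y - ∑ s ∈ Finset.range (k + 1), F (j + s) x * (y - x) ^ s / s.factorial| ≤
        L * (y - x) ^ (β + k) := by
  induction k with
  | zero =>
    rintro j rfl x hx y hy hxy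
    simpa [abs_of_nonneg (sub_nonneg.2 hxy)] using hH y hy x hx
  | succ k ih =>
    intro j hj x hx y hy hxy
    have hsub : Set.Icc x y ⊆ Set.Icc (0 : ℝ) 1 := Set.Icc_subset_Icc hx.1 hy.2
    have hder : ∀ t ∈ Set.Icc x y, HasDerivWithinAt
        (fun t => F j t - ∑ s ∈ Finset.range (k + 1 + 1), F (j + s) x * (t - x) ^ s / s.factorial)
        (F (j + 1) t - ∑ s ∈ Finset.range (k + 1), F (j + 1 + s) x * (t - x) ^ s / s.factorial)
        (Set.Icc x y) t := by
      intro t ht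
      refine ((hF j (by omega) t (hsub ht)).mono hsub).sub ?_
      simp_rw [Finset.sum_range_succ' _ (k + 1), pow_zero]
      apply HasDerivWithinAt.add_const
      apply HasDerivWithinAt.fun_sum
      intro s _
      have h1 : HasDerivAt (fun t : ℝ => (t - x) ^ (s + 1)) (((s + 1 : ℕ) : ℝ) * (t - x) ^ s) t := by
        simpa using ((hasDerivAt_id t).sub_const x).fun_pow (s + 1)
      refine (((h1.const_mul (F (j + (s + 1)) x)).div_const
        ((s + 1).factorial : ℝ)).congr_deriv ?_).hasDerivWithinAt
      rw [show j + (s + 1) = j + 1 + s by ring, Nat.factorial_succ]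
      push_cast
      have : (s.factorial : ℝ) ≠ 0 := by positivity
      have : (s : ℝ) + 1 ≠ 0 := by positivity
      field_simp
    have hbd : ∀ t ∈ Set.Icc x y,
        ‖F (j + 1) t - ∑ s ∈ Finset.range (k + 1), F (j + 1 + s) x * (t - x) ^ s / s.factorial‖ ≤
          L * (y - x) ^ (β + k) := by
      intro t ht
      refine (ih (j + 1) (by omega) x hx t (hsub ht) ht.1).trans ?_
      have : 0 ≤ t - x := sub_nonneg.2 ht.1
      have : t - x ≤ y - x := by linarith [ht.2]
      gcongr
    have := Convex.norm_image_sub_le_of_norm_hasDerivWithin_le hder hbd (convex_Icc x y)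
      (Set.left_mem_Icc.2 hxy) (Set.right_mem_Icc.2 hxy)
    have h0 : F j x - ∑ s ∈ Finset.range (k + 1 + 1), F (j + s) x * (x - x) ^ s / s.factorial
        = 0 := by
      simp [Finset.sum_range_succ' _ (k + 1)]
    simp only [h0, sub_zero, Real.norm_eq_abs, abs_of_nonneg (sub_nonneg.2 hxy)] at this
    refine this.trans_eq ?_
    rw [mul_assoc, Nat.cast_succ, ← add_assoc,
      Real.rpow_add_one' (sub_nonneg.2 hxy) (by positivity)]

/-- On polynomials of bounded degree, the coefficients are controlled by the `L¹` norm on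
`[0,1]`. -/
lemma exists_coeff_le_mul_integral_abs (l : ℕ) :
    ∃ K : ℝ, 0 < K ∧ ∀ c : Fin (l + 1) → ℝ, ∀ j,
      |c j| ≤ K * ∫ x in Set.Icc (0 : ℝ) 1, |∑ i, c i * x ^ (i : ℕ)| := by
  have hintegrable : ∀ f : ℝ → ℝ, Continuous f → Integrable f (volume.restrict (Set.Icc (0 : ℝ) 1)) :=
    fun f hf => hf.continuousOn.integrableOn_Icc
  let T : (Fin (l + 1) → ℝ) →ₗ[ℝ] (Fin (l + 1) → ℝ) :=
    { toFun := fun c k => ∫ x in Set.Icc (0 : ℝ) 1, (∑ i, c i * x ^ (i : ℕ)) * x ^ (k : ℕ)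
      map_add' := fun c c' => by
        ext k
        simp only [Pi.add_apply]
        rw [← integral_add (hintegrable _ (by fun_prop)) (hintegrable _ (by fun_prop))]
        simp only [add_mul, Finset.sum_add_distrib]
      map_smul' := fun a c => by
        ext k
        simp only [Pi.smul_apply, smul_eq_mul, RingHom.id_apply]
        rw [← integral_const_mul]
        simp only [mul_assoc, ← Finset.mul_sum] }
  have hT : ∀ c k, T c k = ∫ x in Set.Icc (0 : ℝ) 1, (∑ i, c i * x ^ (i : ℕ)) * x ^ (k : ℕ) :=
    fun _ _ => rfl
  have hker : T.ker = ⊥ := by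
    refine LinearMap.ker_eq_bot'.2 fun c hc => ?_
    have hsq : ∫ x in Set.Icc (0 : ℝ) 1, (∑ i, c i * x ^ (i : ℕ)) ^ 2 = 0 := by
      have h1 : ∀ x : ℝ, (∑ i, c i * x ^ (i : ℕ)) ^ 2 =
          ∑ k, c k * ((∑ i, c i * x ^ (i : ℕ)) * x ^ (k : ℕ)) := by
        intro x
        rw [sq, Finset.mul_sum]
        exact Finset.sum_congr rfl fun k _ => by ring
      simp_rw [h1]
      rw [integral_finsetSum _ fun k _ => hintegrable _ (by fun_prop)]
      simp_rw [integral_const_mul, ← hT, hc]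
      simp
    have hae := (setIntegral_eq_zero_iff_of_nonneg_ae (.of_forall fun x => sq_nonneg _)
      (hintegrable _ (by fun_prop))).1 hsq
    have heq := Measure.eqOn_Icc_of_ae_eq volume zero_ne_one hae
      (by fun_prop) (by fun_prop)
    let p : Polynomial ℝ := ∑ i : Fin (l + 1), Polynomial.monomial (i : ℕ) (c i)
    have hp : p = 0 := by
      refine Polynomial.eq_zero_of_infinite_isRoot p
        ((Set.Icc_infinite (zero_lt_one (α := ℝ))).mono fun x hx => ?_)
      have := heq hx
      simp only [Pi.zero_apply, ne_eq, OfNat.ofNat_ne_zero, not_false_eq_true,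
        pow_eq_zero_iff] at this
      simpa [p, Polynomial.eval_finsetSum] using this
    ext j
    have := congrArg (fun r => Polynomial.coeff r (j : ℕ)) hp
    simpa [p, Polynomial.coeff_monomial, Fin.val_inj] using this
  obtain ⟨K, hK, hanti⟩ := T.exists_antilipschitzWith hker
  refine ⟨K, by exact_mod_cast hK, fun c j => ?_⟩
  have h1 : ‖c‖ ≤ K * ‖T c‖ := by
    simpa using hanti.le_mul_dist c 0
  refine ((norm_le_pi_norm c j).trans h1).trans ?_
  gcongr
  refine (pi_norm_le_iff_of_nonneg (integral_nonneg fun _ => abs_nonneg _)).2 fun k => ?_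
  rw [hT]
  refine (norm_integral_le_integral_norm _).trans ?_
  refine setIntegral_mono_on (hintegrable _ (by fun_prop)) (hintegrable _ (by fun_prop)) measurableSet_Icc
    fun x hx => ?_
  rw [norm_mul, Real.norm_eq_abs, Real.norm_eq_abs, abs_pow, abs_of_nonneg hx.1]
  exact mul_le_of_le_one_right (abs_nonneg _) (pow_le_one₀ hx.1 hx.2)

lemma holderInt_lt {q : ℝ} (hq : 0 < q) : (holderInt q : ℝ) < q := by
  have h : 0 < ⌈q⌉₊ := Nat.ceil_pos.2 hq
  rw [holderInt]
  exact Nat.lt_ceil.1 (by omega)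

lemma HolderClass.abs_sub_taylor_le {q L : ℝ} (hq : 0 < q) (hL : 0 < L) {f : ℝ → ℝ}
    (hf : f ∈ HolderClass L q) {j : ℕ} (hj : j ≤ holderInt q) {x y : ℝ}
    (hx : x ∈ Set.Icc (0 : ℝ) 1) (hy : y ∈ Set.Icc (0 : ℝ) 1) (hxy : x ≤ y) :
    |iteratedDerivWithin j f (Set.Icc 0 1) y -
      ∑ s ∈ Finset.range (holderInt q - j + 1),
        iteratedDerivWithin (j + s) f (Set.Icc 0 1) x * (y - x) ^ s / s.factorial| ≤
      L * (y - x) ^ (q - j) := by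
  obtain ⟨-, -, hC, hH⟩ := hf
  have hu : UniqueDiffOn ℝ (Set.Icc (0 : ℝ) 1) := uniqueDiffOn_Icc zero_lt_one
  have hF : ∀ j < holderInt q, ∀ x ∈ Set.Icc (0 : ℝ) 1,
      HasDerivWithinAt (iteratedDerivWithin j f (Set.Icc 0 1))
        (iteratedDerivWithin (j + 1) f (Set.Icc 0 1) x) (Set.Icc 0 1) x := by
    intro j hj x hx
    rw [iteratedDerivWithin_succ]
    exact (hC.differentiableOn_iteratedDerivWithin (by exact_mod_cast hj) hu x hx).hasDerivWithinAt
  have := abs_sub_taylor_le_of_holder (F := fun j => iteratedDerivWithin j f (Set.Icc 0 1))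
    (sub_pos.2 (holderInt_lt hq)) hL.le hF hH (holderInt q - j) j (by omega) x hx y hy hxy
  rwa [Nat.cast_sub hj, sub_add_sub_cancel] at this

lemma HolderClass.integrableOn {q L : ℝ} {f : ℝ → ℝ} (hf : f ∈ HolderClass L q) :
    IntegrableOn f (Set.Icc 0 1) :=
  hf.2.2.1.continuousOn.integrableOn_Icc

lemma HolderClass.exists_iteratedDerivWithin_zero_le {q L : ℝ} (hq : 0 < q) (hL : 0 < L) :
    ∃ B : ℝ, 0 < B ∧ ∀ f ∈ HolderClass L q, ∀ j ≤ holderInt q,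
      |iteratedDerivWithin j f (Set.Icc 0 1) 0| ≤ B := by
  obtain ⟨K, hK, hcoeff⟩ := exists_coeff_le_mul_integral_abs (holderInt q)
  refine ⟨(holderInt q).factorial * (K * (1 + L)), by positivity, fun f hf j hj => ?_⟩
  let c : Fin (holderInt q + 1) → ℝ :=
    fun i => iteratedDerivWithin i f (Set.Icc 0 1) 0 / (i : ℕ).factorial
  have hP : ∀ x ∈ Set.Icc (0 : ℝ) 1, |∑ i, c i * x ^ (i : ℕ)| ≤ f x + L := by
    intro x hx
    have h := HolderClass.abs_sub_taylor_le hq hL hf (Nat.zero_le _)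
      (Set.left_mem_Icc.2 zero_le_one) hx hx.1
    have hsum : ∑ s ∈ Finset.range (holderInt q - 0 + 1),
        iteratedDerivWithin (0 + s) f (Set.Icc 0 1) 0 * (x - 0) ^ s / s.factorial =
        ∑ i, c i * x ^ (i : ℕ) := by
      rw [Finset.sum_range]
      refine Finset.sum_congr rfl fun i _ => ?_
      simp only [c, zero_add, sub_zero]
      ring
    rw [hsum, iteratedDerivWithin_zero] at h
    have h1 : (x - 0) ^ (q - (0 : ℕ)) ≤ 1 := by
      simpa using Real.rpow_le_one hx.1 hx.2 hq.le
    have h2 := mul_le_of_le_one_right hL.le h1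
    have h3 := hf.1 x hx
    rw [abs_le] at h ⊢
    constructor <;> linarith [h.1, h.2]
  have hintegrable : ∫ x in Set.Icc (0 : ℝ) 1, |∑ i, c i * x ^ (i : ℕ)| ≤ 1 + L := by
    have hL' : IntegrableOn (fun _ : ℝ => L) (Set.Icc 0 1) := continuous_const.integrableOn_Icc
    refine (setIntegral_mono_on (Continuous.integrableOn_Icc (by fun_prop))
      ((HolderClass.integrableOn hf).add hL') measurableSet_Icc hP).trans_eq ?_
    simp only [Pi.add_apply]
    rw [integral_add (HolderClass.integrableOn hf) hL', hf.2.1]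
    simp
  have hc : |c ⟨j, by omega⟩| ≤ K * (1 + L) := (hcoeff c _).trans (by gcongr)
  simp only [c, abs_div, Nat.abs_cast] at hc
  rw [div_le_iff₀ (by positivity)] at hc
  rw [mul_comm]
  refine hc.trans ?_
  gcongr

/-- The derivatives of `f` at the grid point `i / n`, in units in which the resolution `n ^ (-q)`
and the mesh `1 / n` are both equal to one. -/
noncomputable def scaledJet (q : ℝ) (n : ℕ) (f : ℝ → ℝ) (i j : ℕ) : ℝ :=
  iteratedDerivWithin j f (Set.Icc 0 1) (i / n) * (1 / n) ^ j * (n : ℝ) ^ q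

/-- The error made when predicting the integer part of the scaled jet at the grid point `i + 1` by
Taylor expansion of the integer parts at the grid point `i`. -/
noncomputable def jetResidual (q : ℝ) (n : ℕ) (f : ℝ → ℝ) (i j : ℕ) : ℤ :=
  ⌊scaledJet q n f (i + 1) j⌋ - ⌊∑ s ∈ Finset.range (holderInt q - j + 1),
    (⌊scaledJet q n f i (j + s)⌋ : ℝ) / s.factorial⌋

lemma abs_floor_sub_floor_le (u v : ℝ) : ((|⌊u⌋ - ⌊v⌋| : ℤ) : ℝ) ≤ |u - v| + 1 := by
  push_cast
  rw [abs_le]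
  have h1 := Int.floor_le u
  have h2 := Int.lt_floor_add_one u
  have h3 := Int.floor_le v
  have h4 := Int.lt_floor_add_one v
  constructor <;> linarith [le_abs_self (u - v), neg_abs_le (u - v)]

lemma natCast_div_mem_Icc {i n : ℕ} (h : i ≤ n) : (i : ℝ) / n ∈ Set.Icc (0 : ℝ) 1 :=
  ⟨by positivity, div_le_one_of_le₀ (by exact_mod_cast h) (by positivity)⟩

lemma abs_sum_div_factorial_le {k : ℕ} {a : ℕ → ℝ} {b : ℝ}
    (h : ∀ s ∈ Finset.range k, |a s| ≤ b) :
    |∑ s ∈ Finset.range k, a s / s.factorial| ≤ k * b := by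
  refine (Finset.abs_sum_le_sum_abs _ _).trans ?_
  calc ∑ s ∈ Finset.range k, |a s / s.factorial| ≤ ∑ s ∈ Finset.range k, b := by
        refine Finset.sum_le_sum fun s hs => ?_
        rw [abs_div, Nat.abs_cast]
        refine (div_le_self (abs_nonneg _) ?_).trans (h s hs)
        exact_mod_cast Nat.one_le_iff_ne_zero.2 s.factorial_ne_zero
    _ = k * b := by simp

lemma abs_scaledJet_succ_sub_le {q L : ℝ} (hq : 0 < q) (hL : 0 < L) {f : ℝ → ℝ}
    (hf : f ∈ HolderClass L q) {n i j : ℕ} (hi : i < n) (hj : j ≤ holderInt q) :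
    |scaledJet q n f (i + 1) j - ∑ s ∈ Finset.range (holderInt q - j + 1),
      scaledJet q n f i (j + s) / s.factorial| ≤ L := by
  have hn : (0 : ℝ) < n := by exact_mod_cast (by omega : 0 < n)
  have h := HolderClass.abs_sub_taylor_le hq hL hf hj (natCast_div_mem_Icc hi.le)
    (natCast_div_mem_Icc (Nat.succ_le_of_lt hi)) (by gcongr; omega)
  have hstep : ((i.succ : ℕ) : ℝ) / n - i / n = 1 / n := by
    push_cast
    ring
  rw [hstep] at h
  have hfac : (0 : ℝ) < (1 / n) ^ j * (n : ℝ) ^ q := by positivity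
  have heq : scaledJet q n f (i + 1) j - ∑ s ∈ Finset.range (holderInt q - j + 1),
      scaledJet q n f i (j + s) / s.factorial =
      (iteratedDerivWithin j f (Set.Icc 0 1) ((i.succ : ℕ) / n) -
      ∑ s ∈ Finset.range (holderInt q - j + 1),
        iteratedDerivWithin (j + s) f (Set.Icc 0 1) (i / n) * (1 / n) ^ s / s.factorial) *
        ((1 / n) ^ j * (n : ℝ) ^ q) := by
    rw [sub_mul, Finset.sum_mul]
    simp only [scaledJet]
    congr 1
    · ring
    · refine Finset.sum_congr rfl fun s _ => ?_
      rw [pow_add]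
      ring
  rw [heq, abs_mul, abs_of_pos hfac]
  refine (mul_le_mul_of_nonneg_right h hfac.le).trans_eq ?_
  rw [one_div, Real.inv_rpow hn.le, ← Real.rpow_neg hn.le, inv_pow, ← Real.rpow_natCast,
    ← Real.rpow_neg hn.le, mul_assoc, ← Real.rpow_add hn, ← Real.rpow_add hn]
  simp

lemma abs_jetResidual_le {q L : ℝ} (hq : 0 < q) (hL : 0 < L) {f : ℝ → ℝ}
    (hf : f ∈ HolderClass L q) {n i j : ℕ} (hi : i < n) (hj : j ≤ holderInt q) :
    ((|jetResidual q n f i j| : ℤ) : ℝ) ≤ L + holderInt q + 2 := by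
  refine (abs_floor_sub_floor_le _ _).trans ?_
  have h1 := abs_scaledJet_succ_sub_le hq hL hf hi hj
  have h2 : |∑ s ∈ Finset.range (holderInt q - j + 1),
      (scaledJet q n f i (j + s) - ⌊scaledJet q n f i (j + s)⌋) / s.factorial| ≤
      ((holderInt q - j + 1 : ℕ) : ℝ) * 1 := by
    refine abs_sum_div_factorial_le (a := fun s =>
      scaledJet q n f i (j + s) - ⌊scaledJet q n f i (j + s)⌋) fun s _ => ?_
    rw [Int.self_sub_floor, abs_of_nonneg (Int.fract_nonneg _)]
    exact (Int.fract_lt_one _).le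
  have h3 : ((holderInt q - j + 1 : ℕ) : ℝ) ≤ holderInt q + 1 := by
    exact_mod_cast (by omega : holderInt q - j + 1 ≤ holderInt q + 1)
  simp only [sub_div, Finset.sum_sub_distrib] at h2
  have := abs_sub_le (scaledJet q n f (i + 1) j) (∑ s ∈ Finset.range (holderInt q - j + 1),
      scaledJet q n f i (j + s) / s.factorial) (∑ s ∈ Finset.range (holderInt q - j + 1),
      (⌊scaledJet q n f i (j + s)⌋ : ℝ) / s.factorial)
  linarith

lemma floor_scaledJet_eq {q : ℝ} {f g : ℝ → ℝ} {n : ℕ}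
    (h0 : ∀ j ≤ holderInt q, ⌊scaledJet q n f 0 j⌋ = ⌊scaledJet q n g 0 j⌋)
    (hres : ∀ i < n, ∀ j ≤ holderInt q, jetResidual q n f i j = jetResidual q n g i j) :
    ∀ i ≤ n, ∀ j ≤ holderInt q, ⌊scaledJet q n f i j⌋ = ⌊scaledJet q n g i j⌋ := by
  intro i
  induction i with
  | zero => exact fun _ => h0
  | succ i ih =>
    intro hi j hj
    have h := hres i hi j hj
    have hsum : ∑ s ∈ Finset.range (holderInt q - j + 1),
        (⌊scaledJet q n f i (j + s)⌋ : ℝ) / s.factorial =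
        ∑ s ∈ Finset.range (holderInt q - j + 1),
        (⌊scaledJet q n g i (j + s)⌋ : ℝ) / s.factorial := by
      refine Finset.sum_congr rfl fun s hs => ?_
      rw [ih (by omega) (j + s) (by have := Finset.mem_range.1 hs; omega)]
    rw [jetResidual, jetResidual, hsum] at h
    exact sub_left_injective h

/-- Functions of the Hölder class whose scaled jets have the same integer parts on the grid are
uniformly close. -/
lemma abs_sub_le_of_floor_scaledJet_eq {q L : ℝ} (hq : 0 < q) (hL : 0 < L) {f g : ℝ → ℝ}
    (hf : f ∈ HolderClass L q) (hg : g ∈ HolderClass L q) {n : ℕ} (hn : 1 ≤ n)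
    (h : ∀ i ≤ n, ∀ j ≤ holderInt q, ⌊scaledJet q n f i j⌋ = ⌊scaledJet q n g i j⌋)
    {x : ℝ} (hx : x ∈ Set.Icc (0 : ℝ) 1) :
    |f x - g x| ≤ (2 * L + holderInt q + 1) * (n : ℝ) ^ (-q) := by
  have hn0 : (0 : ℝ) < n := by exact_mod_cast hn
  set i := ⌊n * x⌋₊ with hi
  have hnx : 0 ≤ n * x := mul_nonneg hn0.le hx.1
  have hin : i ≤ n := Nat.floor_le_of_le (mul_le_of_le_one_right hn0.le hx.2)
  have hix : (i : ℝ) / n ≤ x := by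
    rw [div_le_iff₀ hn0, mul_comm]
    exact Nat.floor_le hnx
  have hxi : x - i / n ≤ 1 / n := by
    rw [sub_le_iff_le_add, ← add_div, le_div_iff₀ hn0, add_comm, mul_comm]
    exact (Nat.lt_floor_add_one _).le
  have hnn : 0 ≤ x - i / n := sub_nonneg.2 hix
  have hpow : L * (x - i / n) ^ (q - (0 : ℕ)) ≤ L * (n : ℝ) ^ (-q) := by
    rw [Real.rpow_neg hn0.le, ← Real.inv_rpow hn0.le, ← one_div, Nat.cast_zero, sub_zero]
    gcongr
  have htf := (HolderClass.abs_sub_taylor_le hq hL hf (Nat.zero_le _)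
    (natCast_div_mem_Icc hin) hx hix).trans hpow
  have htg := (HolderClass.abs_sub_taylor_le hq hL hg (Nat.zero_le _)
    (natCast_div_mem_Icc hin) hx hix).trans hpow
  have hdiff : |∑ s ∈ Finset.range (holderInt q - 0 + 1),
      (iteratedDerivWithin (0 + s) f (Set.Icc 0 1) (i / n) * (x - i / n) ^ s -
        iteratedDerivWithin (0 + s) g (Set.Icc 0 1) (i / n) * (x - i / n) ^ s) / s.factorial| ≤
      ((holderInt q - 0 + 1 : ℕ) : ℝ) * (n : ℝ) ^ (-q) := by
    refine abs_sum_div_factorial_le (a := fun s =>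
      iteratedDerivWithin (0 + s) f (Set.Icc 0 1) (i / n) * (x - i / n) ^ s -
        iteratedDerivWithin (0 + s) g (Set.Icc 0 1) (i / n) * (x - i / n) ^ s) fun s hs => ?_
    have hfl := h i hin s (by have := Finset.mem_range.1 hs; omega)
    have h1 := (Int.abs_sub_lt_one_of_floor_eq_floor hfl).le
    rw [scaledJet, scaledJet, ← sub_mul, ← sub_mul, abs_mul, abs_of_pos (a := (n : ℝ) ^ q)
      (by positivity), ← le_div_iff₀ (by positivity), one_div ((n : ℝ) ^ q),
      ← Real.rpow_neg hn0.le, abs_mul, abs_of_pos (a := (1 / (n : ℝ)) ^ s) (by positivity)] at h1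
    rw [← sub_mul, abs_mul, abs_of_nonneg (pow_nonneg hnn s), zero_add]
    refine le_trans ?_ h1
    gcongr
  simp only [sub_div, Finset.sum_sub_distrib] at hdiff
  rw [iteratedDerivWithin_zero] at htf htg
  simp only [Nat.sub_zero, zero_add, Nat.cast_add, Nat.cast_one] at htf htg hdiff
  rw [abs_le] at htf htg hdiff ⊢
  constructor <;> linarith [htf.1, htf.2, htg.1, htg.2, hdiff.1, hdiff.2]

/-- Every element of the Hölder class has a code in a set of `exp (C n)` elements that determines it
up to a uniform error of order `n ^ (-q)`. -/
lemma HolderClass.exists_code_of_grid {q L : ℝ} (hq : 0 < q) (hL : 0 < L) :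
    ∃ C : ℝ, 0 < C ∧ ∀ n : ℕ, 1 ≤ n →
      ∃ (ι : Type) (S : Finset ι) (code : (ℝ → ℝ) → ι), (S.card : ℝ) ≤ Real.exp (C * n) ∧
        (∀ f ∈ HolderClass L q, code f ∈ S) ∧
        ∀ f ∈ HolderClass L q, ∀ g ∈ HolderClass L q, code f = code g →
          ∀ x ∈ Set.Icc (0 : ℝ) 1,
            |f x - g x| ≤ (2 * L + holderInt q + 1) * (n : ℝ) ^ (-q) := by
  obtain ⟨B, hB, hbound⟩ := HolderClass.exists_iteratedDerivWithin_zero_le hq hL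
  set l := holderInt q with hl
  set r := ⌈L + l + 2⌉₊ with hr
  refine ⟨(l + 1) * (2 * B + 5 + q + 2 * r), by positivity, fun n hn => ?_⟩
  have hn0 : (0 : ℝ) < n := by exact_mod_cast hn
  have hn1 : (1 : ℝ) ≤ n := by exact_mod_cast hn
  set a := ⌈B * (n : ℝ) ^ q⌉₊ + 1 with ha
  let S : Finset ((Fin (l + 1) → ℤ) × (Fin n → Fin (l + 1) → ℤ)) :=
    (Fintype.piFinset fun _ => Finset.Icc (-(a : ℤ)) a) ×ˢ
      (Fintype.piFinset fun _ => Fintype.piFinset fun _ => Finset.Icc (-(r : ℤ)) r)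
  refine ⟨_, S, fun f => (fun j => ⌊scaledJet q n f 0 j⌋, fun i j => jetResidual q n f i j),
    ?_, ?_, ?_⟩
  · have hcard : S.card = (2 * a + 1) ^ (l + 1) * ((2 * r + 1) ^ (l + 1)) ^ n := by
      have h : ∀ b : ℕ, (Finset.Icc (-(b : ℤ)) b).card = 2 * b + 1 := by
        intro b
        rw [Int.card_Icc]
        omega
      simp only [S, Finset.card_product, Fintype.card_piFinset_const, h]
    have hnq : (1 : ℝ) ≤ (n : ℝ) ^ q := Real.one_le_rpow hn1 hq.le
    have h1 : (2 * a + 1 : ℝ) ≤ Real.exp ((2 * B + 5 + q) * n) := by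
      have hceil := Nat.ceil_lt_add_one (a := B * (n : ℝ) ^ q) (by positivity)
      have ha' : (a : ℝ) = (⌈B * (n : ℝ) ^ q⌉₊ : ℝ) + 1 := by simp [ha]
      calc (2 * a + 1 : ℝ) ≤ (2 * B + 5) * (n : ℝ) ^ q := by nlinarith
        _ ≤ Real.exp ((2 * B + 5) * n) * Real.exp (q * n) := by
            have e1 : 2 * B + 5 ≤ Real.exp ((2 * B + 5) * n) := by
              have := Real.add_one_le_exp ((2 * B + 5) * n)
              nlinarith
            have e2 : (n : ℝ) ^ q ≤ Real.exp (q * n) := by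
              rw [Real.rpow_def_of_pos hn0, mul_comm q]
              have := Real.log_le_self hn0.le
              gcongr
            gcongr
        _ = Real.exp ((2 * B + 5 + q) * n) := by
            rw [← Real.exp_add]
            ring_nf
    have h2 : (2 * r + 1 : ℝ) ≤ Real.exp (2 * r) := Real.add_one_le_exp _
    rw [hcard]
    push_cast
    calc (2 * a + 1 : ℝ) ^ (l + 1) * ((2 * r + 1) ^ (l + 1)) ^ n
        ≤ Real.exp ((2 * B + 5 + q) * n) ^ (l + 1) * (Real.exp (2 * r) ^ (l + 1)) ^ n := by gcongr
      _ = Real.exp ((l + 1) * (2 * B + 5 + q + 2 * r) * n) := by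
          rw [← Real.exp_nat_mul, ← Real.exp_nat_mul, ← Real.exp_nat_mul, ← Real.exp_add]
          push_cast
          ring_nf
  · intro f hf
    simp only [S, Finset.mem_product, Fintype.mem_piFinset, Finset.mem_Icc, ← abs_le]
    constructor
    · intro j
      have h1 : |scaledJet q n f 0 j| ≤ B * (n : ℝ) ^ q := by
        have hb := hbound f hf j (Nat.lt_succ_iff.1 j.2)
        have hp : (1 / (n : ℝ)) ^ (j : ℕ) ≤ 1 :=
          pow_le_one₀ (by positivity) (by rw [div_le_one hn0]; exact hn1)
        rw [scaledJet, Nat.cast_zero, zero_div, abs_mul, abs_mul,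
          abs_of_pos (a := (n : ℝ) ^ q) (by positivity),
          abs_of_pos (a := (1 / (n : ℝ)) ^ (j : ℕ)) (by positivity)]
        gcongr
        exact (mul_le_of_le_one_right (abs_nonneg _) hp).trans hb
      have h2 := abs_floor_sub_floor_le (scaledJet q n f 0 j) 0
      rw [Int.floor_zero, sub_zero, sub_zero] at h2
      have h3 : ((|⌊scaledJet q n f 0 j⌋| : ℤ) : ℝ) ≤ ((a : ℤ) : ℝ) := by
        have := Nat.le_ceil (B * (n : ℝ) ^ q)
        rw [Int.cast_natCast]
        simp only [ha, Nat.cast_add, Nat.cast_one]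
        linarith
      exact_mod_cast h3
    · intro i j
      have h : ((|jetResidual q n f i j| : ℤ) : ℝ) ≤ ((r : ℤ) : ℝ) := by
        rw [Int.cast_natCast]
        exact (abs_jetResidual_le hq hL hf i.2 (Nat.lt_succ_iff.1 j.2)).trans (Nat.le_ceil _)
      exact_mod_cast h
  · intro f hf g hg hfg x hx
    rw [Prod.mk.injEq] at hfg
    refine abs_sub_le_of_floor_scaledJet_eq hq hL hf hg hn (floor_scaledJet_eq ?_ ?_) hx
    · exact fun j hj => congrFun hfg.1 ⟨j, Nat.lt_succ_of_le hj⟩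
    · exact fun i hi j hj => congrFun (congrFun hfg.2 ⟨i, hi⟩) ⟨j, Nat.lt_succ_of_le hj⟩

/-- Kolmogorov–Tikhomirov entropy bound for the Hölder class in the uniform norm. -/
lemma HolderClass.exists_code {q L : ℝ} (hq : 0 < q) (hL : 0 < L) :
    ∃ C : ℝ, 0 < C ∧ ∀ δ : ℝ, 0 < δ → δ ≤ 1 →
      ∃ (ι : Type) (S : Finset ι) (code : (ℝ → ℝ) → ι),
        (S.card : ℝ) ≤ Real.exp (C * (1 / δ) ^ (1 / q)) ∧
        (∀ f ∈ HolderClass L q, code f ∈ S) ∧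
        ∀ f ∈ HolderClass L q, ∀ g ∈ HolderClass L q, code f = code g →
          ∀ x ∈ Set.Icc (0 : ℝ) 1, |f x - g x| ≤ δ := by
  obtain ⟨C, hC, h⟩ := HolderClass.exists_code_of_grid hq hL
  set A : ℝ := 2 * L + holderInt q + 1 with hA
  have hA0 : 0 < A := by positivity
  refine ⟨C * (A ^ (1 / q) + 1), by positivity, fun δ hδ hδ1 => ?_⟩
  have hpos : 0 < (A / δ) ^ (1 / q) := by positivity
  obtain ⟨ι, S, code, hcard, hmem, hclose⟩ := h ⌈(A / δ) ^ (1 / q)⌉₊ (Nat.ceil_pos.2 hpos)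
  refine ⟨ι, S, code, hcard.trans ?_, hmem, fun f hf g hg hfg x hx =>
    (hclose f hf g hg hfg x hx).trans ?_⟩
  · rw [mul_assoc]
    gcongr
    have h1 := (Nat.ceil_lt_add_one hpos.le).le
    have h2 : (A / δ) ^ (1 / q) = A ^ (1 / q) * (1 / δ) ^ (1 / q) := by
      rw [← Real.mul_rpow hA0.le (by positivity), mul_one_div]
    have h3 : 1 ≤ (1 / δ) ^ (1 / q) :=
      Real.one_le_rpow ((one_le_div hδ).2 hδ1) (by positivity)
    linarith
  · have h1 : A / δ ≤ (⌈(A / δ) ^ (1 / q)⌉₊ : ℝ) ^ q := by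
      calc A / δ = ((A / δ) ^ (1 / q)) ^ q := by
            rw [one_div, Real.rpow_inv_rpow (by positivity) hq.ne']
        _ ≤ _ := by
            gcongr
            exact Nat.le_ceil _
    rw [Real.rpow_neg (by positivity), ← div_eq_mul_inv,
      div_le_iff₀ (lt_of_lt_of_le (by positivity) h1)]
    rwa [div_le_iff₀' hδ] at h1

/-- The number of vectors of `m` natural numbers with sum at most `M m` is at most
`(e (M + 1)) ^ m`. -/
lemma card_filter_sum_le (m M : ℕ) (hM : 1 ≤ M) :
    (((Fintype.piFinset fun _ : Fin m => Finset.range (M * m + 1)).filter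
      fun n => ∑ k, n k ≤ M * m).card : ℝ) ≤ (Real.exp 1 * (M + 1)) ^ m := by
  set S := (Fintype.piFinset fun _ : Fin m => Finset.range (M * m + 1)).filter
      fun n => ∑ k, n k ≤ M * m with hS
  have hM0 : (0 : ℝ) < M := by exact_mod_cast hM
  set t : ℝ := M / (M + 1) with ht
  have ht0 : 0 < t := by positivity
  have ht1 : t < 1 := by
    rw [ht, div_lt_one (by positivity)]
    linarith
  have h1t : 1 - t = 1 / (M + 1) := by
    rw [ht]
    field_simp
    ring
  have hgeom : ∑ i ∈ Finset.range (M * m + 1), t ^ i ≤ M + 1 := by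
    have h := mul_neg_geom_sum t (M * m + 1)
    rw [h1t] at h
    have : 0 ≤ t ^ (M * m + 1) := by positivity
    have h' : 1 / ((M : ℝ) + 1) * ∑ i ∈ Finset.range (M * m + 1), t ^ i ≤ 1 := by linarith
    rwa [one_div_mul_eq_div, div_le_one (by positivity)] at h'
  have hsum : (S.card : ℝ) * t ^ (M * m) ≤ (M + 1) ^ m := by
    calc (S.card : ℝ) * t ^ (M * m) = ∑ n ∈ S, t ^ (M * m) := by simp
      _ ≤ ∑ n ∈ S, ∏ k, t ^ n k := by
          refine Finset.sum_le_sum fun n hn => ?_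
          rw [Finset.prod_pow_eq_pow_sum]
          exact pow_le_pow_of_le_one ht0.le ht1.le (Finset.mem_filter.1 hn).2
      _ ≤ ∑ n ∈ Fintype.piFinset fun _ : Fin m => Finset.range (M * m + 1), ∏ k, t ^ n k :=
          Finset.sum_le_sum_of_subset_of_nonneg (Finset.filter_subset _ _)
            fun _ _ _ => by positivity
      _ = (∑ i ∈ Finset.range (M * m + 1), t ^ i) ^ m := by
          rw [← Finset.prod_univ_sum (fun _ : Fin m => Finset.range (M * m + 1)) fun _ i => t ^ i]
          simp
      _ ≤ _ := by gcongr
  have hexp : Real.exp (-1) ≤ t ^ M := by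
    have h1 : Real.exp (-(1 / M)) ≤ t := by
      rw [Real.exp_neg, inv_le_comm₀ (Real.exp_pos _) ht0]
      refine le_trans (le_of_eq ?_) (Real.add_one_le_exp _)
      rw [ht]
      field_simp
      exact add_comm _ _
    calc Real.exp (-1) = Real.exp (-(1 / M)) ^ M := by
          rw [← Real.exp_nat_mul]
          congr 1
          field_simp
      _ ≤ _ := by gcongr
  have h2 : (S.card : ℝ) * Real.exp (-1) ^ m ≤ (M + 1) ^ m := by
    refine le_trans ?_ hsum
    rw [pow_mul]
    gcongr
  rw [Real.exp_neg, inv_pow, ← div_eq_mul_inv, div_le_iff₀ (by positivity)] at h2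
  rwa [mul_pow, mul_comm]

/-- The `L¹` distance of two product densities is at most the sum of the `L¹` distances of their
factors. -/
lemma integral_abs_prod_sub_prod_le {d : ℕ} {μ : Measure ℝ} [SigmaFinite μ]
    {f g : Fin d → ℝ → ℝ} (hf : ∀ j, Integrable (f j) μ) (hg : ∀ j, Integrable (g j) μ)
    (hf1 : ∀ j, ∫ x, |f j x| ∂μ ≤ 1) (hg1 : ∀ j, ∫ x, |g j x| ∂μ ≤ 1) :
    ∫ x, |∏ j, f j (x j) - ∏ j, g j (x j)| ∂(Measure.pi fun _ : Fin d => μ) ≤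
      ∑ j, ∫ x, |f j x - g j x| ∂μ := by
  let u : Fin d → Fin d → ℝ → ℝ := fun i j x =>
    if j < i then |g j x| else if i < j then |f j x| else |f j x - g j x|
  have hu : ∀ i j, Integrable (u i j) μ := by
    intro i j
    by_cases h1 : j < i
    · simpa only [u, h1, if_true] using (hg j).abs
    by_cases h2 : i < j
    · simpa only [u, h1, h2, if_true, if_false] using (hf j).abs
    · simpa only [u, h1, h2, if_false, Pi.sub_apply] using ((hf j).sub (hg j)).abs
  have hprod : ∀ i, Integrable (fun x : Fin d → ℝ => ∏ j, u i j (x j))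
      (Measure.pi fun _ : Fin d => μ) := fun i => Integrable.fintype_prod (hu i)
  have hpt : ∀ x : Fin d → ℝ, |∏ j, f j (x j) - ∏ j, g j (x j)| ≤ ∑ i, ∏ j, u i j (x j) := by
    intro x
    have h := Finset.prod_sub_ordered Finset.univ (fun j => f j (x j))
      (fun j => f j (x j) - g j (x j))
    simp only [sub_sub_cancel] at h
    rw [h, sub_sub_cancel]
    refine (Finset.abs_sum_le_sum_abs _ _).trans (Finset.sum_le_sum fun i _ => le_of_eq ?_)
    simp only [u]
    rw [Finset.prod_ite, Finset.prod_ite, Finset.filter_filter, Finset.filter_filter]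
    have e1 : (Finset.univ.filter fun j : Fin d => ¬ j < i ∧ i < j) =
        Finset.univ.filter fun j => i < j := by
      ext j
      simp only [Finset.mem_filter, Finset.mem_univ, true_and]
      exact ⟨fun h => h.2, fun h => ⟨h.not_gt, h⟩⟩
    have e2 : (Finset.univ.filter fun j : Fin d => ¬ j < i ∧ ¬ i < j) = {i} := by
      ext j
      simp only [Finset.mem_filter, Finset.mem_univ, true_and, Finset.mem_singleton, not_lt]
      exact ⟨fun h => le_antisymm h.2 h.1, fun h => ⟨h.ge, h.le⟩⟩
    rw [e1, e2, Finset.prod_singleton, abs_mul, abs_mul, Finset.abs_prod, Finset.abs_prod]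
    ring
  have hterm : ∀ i, ∫ x, ∏ j, u i j (x j) ∂(Measure.pi fun _ : Fin d => μ) ≤
      ∫ x, |f i x - g i x| ∂μ := by
    intro i
    rw [integral_fintype_prod_eq_prod, ← Finset.mul_prod_erase _ _ (Finset.mem_univ i)]
    have hi : ∫ x, u i i x ∂μ = ∫ x, |f i x - g i x| ∂μ := by simp [u]
    rw [hi]
    refine mul_le_of_le_one_right (integral_nonneg fun _ => abs_nonneg _) ?_
    refine Finset.prod_le_one (fun j _ => integral_nonneg fun x => ?_) fun j hj => ?_
    · simp only [u, Pi.zero_apply]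
      split_ifs <;> exact abs_nonneg _
    · rcases lt_or_gt_of_ne (Finset.ne_of_mem_erase hj) with h | h
      · simpa only [u, h, if_true] using hg1 j
      · simpa only [u, h, h.not_gt, if_true, if_false] using hf1 j
  calc ∫ x, |∏ j, f j (x j) - ∏ j, g j (x j)| ∂(Measure.pi fun _ : Fin d => μ)
      ≤ ∫ x, ∑ i, ∏ j, u i j (x j) ∂(Measure.pi fun _ : Fin d => μ) :=
        integral_mono ((Integrable.fintype_prod hf).sub (Integrable.fintype_prod hg)).abs
          (integrable_finsetSum _ fun i _ => hprod i) hpt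
    _ = ∑ i, ∫ x, ∏ j, u i j (x j) ∂(Measure.pi fun _ : Fin d => μ) :=
        integral_finsetSum _ fun i _ => hprod i
    _ ≤ _ := Finset.sum_le_sum fun i _ => hterm i

lemma volume_restrict_unitCube (d : ℕ) :
    volume.restrict (unitCube d) =
      Measure.pi fun _ : Fin d => volume.restrict (Set.Icc (0 : ℝ) 1) := by
  rw [unitCube, volume_pi, Measure.restrict_pi_pi]

lemma HolderClass.integrable_prod {q L : ℝ} {d : ℕ} {f : Fin d → ℝ → ℝ}
    (hf : ∀ j, f j ∈ HolderClass L q) :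
    IntegrableOn (fun x => ∏ j, f j (x j)) (unitCube d) := by
  rw [IntegrableOn, volume_restrict_unitCube]
  exact Integrable.fintype_prod fun j => HolderClass.integrableOn (hf j)

lemma HolderClass.isDensityOnCube_prod {q L : ℝ} {d : ℕ} {f : Fin d → ℝ → ℝ}
    (hf : ∀ j, f j ∈ HolderClass L q) :
    IsDensityOnCube fun x => ∏ j, f j (x j) := by
  refine ⟨fun x hx => Finset.prod_nonneg fun j _ => (hf j).1 _ (hx j trivial), ?_⟩
  rw [volume_restrict_unitCube, integral_fintype_prod_eq_prod]
  exact Finset.prod_eq_one fun j _ => (hf j).2.1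

lemma HolderClass.integral_abs_prod_sub_prod_le {q L δ : ℝ} {d : ℕ} {f g : Fin d → ℝ → ℝ}
    (hf : ∀ j, f j ∈ HolderClass L q) (hg : ∀ j, g j ∈ HolderClass L q)
    (h : ∀ j, ∀ x ∈ Set.Icc (0 : ℝ) 1, |f j x - g j x| ≤ δ) :
    ∫ x in unitCube d, |∏ j, f j (x j) - ∏ j, g j (x j)| ≤ d * δ := by
  have habs : ∀ {f}, f ∈ HolderClass L q → ∫ x in Set.Icc (0 : ℝ) 1, |f x| ≤ 1 := by
    intro f hf
    rw [setIntegral_congr_fun measurableSet_Icc fun x hx => abs_of_nonneg (hf.1 x hx)]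
    exact hf.2.1.le
  rw [volume_restrict_unitCube]
  refine (_root_.integral_abs_prod_sub_prod_le (fun j => HolderClass.integrableOn (hf j))
    (fun j => HolderClass.integrableOn (hg j)) (fun j => habs (hf j))
    fun j => habs (hg j)).trans ?_
  have hj : ∀ j, ∫ x in Set.Icc (0 : ℝ) 1, |f j x - g j x| ≤ δ := by
    intro j
    refine (setIntegral_mono_on (((HolderClass.integrableOn (hf j)).sub
      (HolderClass.integrableOn (hg j))).abs) continuous_const.integrableOn_Icc
      measurableSet_Icc (h j)).trans_eq ?_
    simp
  exact (Finset.sum_le_sum fun j _ => hj j).trans_eq (by simp)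

lemma sq_sqrt_sub_sqrt_le_abs {a b : ℝ} (ha : 0 ≤ a) (hb : 0 ≤ b) :
    (Real.sqrt a - Real.sqrt b) ^ 2 ≤ |a - b| := by
  have h : a - b = (Real.sqrt a - Real.sqrt b) * (Real.sqrt a + Real.sqrt b) := by
    nlinarith [Real.sq_sqrt ha, Real.sq_sqrt hb]
  rw [h, abs_mul, ← sq_abs, sq]
  refine mul_le_mul_of_nonneg_left ?_ (abs_nonneg _)
  rw [abs_of_nonneg (add_nonneg (Real.sqrt_nonneg a) (Real.sqrt_nonneg b)), abs_le]
  constructor <;> linarith [Real.sqrt_nonneg a, Real.sqrt_nonneg b]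

lemma measurableSet_unitCube (d : ℕ) : MeasurableSet (unitCube d) :=
  MeasurableSet.univ_pi fun _ => measurableSet_Icc

lemma hellingerDist_le_sqrt_integral_abs {d : ℕ} {p r : (Fin d → ℝ) → ℝ}
    (hp : ∀ x ∈ unitCube d, 0 ≤ p x) (hr : ∀ x ∈ unitCube d, 0 ≤ r x)
    (hintegrable : IntegrableOn (fun x => |p x - r x|) (unitCube d)) :
    hellingerDist p r ≤ Real.sqrt (∫ x in unitCube d, |p x - r x|) := by
  refine Real.sqrt_le_sqrt (integral_mono_of_nonneg (.of_forall fun x => sq_nonneg _) hintegrable ?_)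
  exact (ae_restrict_iff' (measurableSet_unitCube d)).2
    (.of_forall fun x hx => sq_sqrt_sub_sqrt_le_abs (hp x hx) (hr x hx))

lemma integral_abs_mixture_sub_le {q L δ η : ℝ} {m d : ℕ} {π ρ : Fin m → ℝ}
    {f g : Fin m → Fin d → ℝ → ℝ} (hρ : ∀ k, 0 ≤ ρ k) (hρ1 : ∑ k, ρ k = 1)
    (hf : ∀ k j, f k j ∈ HolderClass L q) (hg : ∀ k j, g k j ∈ HolderClass L q)
    (hπρ : ∑ k, |π k - ρ k| ≤ η)
    (h : ∀ k j, ∀ x ∈ Set.Icc (0 : ℝ) 1, |f k j x - g k j x| ≤ δ) :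
    ∫ x in unitCube d, |∑ k, π k * ∏ j, f k j (x j) - ∑ k, ρ k * ∏ j, g k j (x j)| ≤
      η + d * δ := by
  have hif := fun k => HolderClass.integrable_prod (hf k)
  have hig := fun k => HolderClass.integrable_prod (hg k)
  have hdiff : ∀ k, IntegrableOn (fun x => |∏ j, f k j (x j) - ∏ j, g k j (x j)|) (unitCube d) :=
    fun k => ((hif k).sub (hig k)).abs
  have hpt : ∀ x ∈ unitCube d,
      |∑ k, π k * ∏ j, f k j (x j) - ∑ k, ρ k * ∏ j, g k j (x j)| ≤
        ∑ k, (|π k - ρ k| * ∏ j, f k j (x j) +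
          ρ k * |∏ j, f k j (x j) - ∏ j, g k j (x j)|) := by
    intro x hx
    rw [← Finset.sum_sub_distrib]
    refine (Finset.abs_sum_le_sum_abs _ _).trans (Finset.sum_le_sum fun k _ => ?_)
    have hP := (HolderClass.isDensityOnCube_prod (hf k)).1 x hx
    rw [show π k * ∏ j, f k j (x j) - ρ k * ∏ j, g k j (x j) =
      (π k - ρ k) * ∏ j, f k j (x j) + ρ k * (∏ j, f k j (x j) - ∏ j, g k j (x j)) by ring]
    refine (abs_add_le _ _).trans_eq ?_
    rw [abs_mul, abs_mul, abs_of_nonneg hP, abs_of_nonneg (hρ k)]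
  have hterm : ∀ k, Integrable (fun x => |π k - ρ k| * ∏ j, f k j (x j) +
      ρ k * |∏ j, f k j (x j) - ∏ j, g k j (x j)|) (volume.restrict (unitCube d)) :=
    fun k => ((hif k).const_mul _).add ((hdiff k).const_mul _)
  refine (setIntegral_mono_on (((integrable_finsetSum _ fun k _ => (hif k).const_mul _).sub
    (integrable_finsetSum _ fun k _ => (hig k).const_mul _)).abs)
    (integrable_finsetSum _ fun k _ => hterm k) (measurableSet_unitCube d) hpt).trans ?_
  rw [integral_finsetSum _ fun k _ => hterm k]
  calc ∑ k, ∫ x in unitCube d, (|π k - ρ k| * ∏ j, f k j (x j) +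
          ρ k * |∏ j, f k j (x j) - ∏ j, g k j (x j)|)
      ≤ ∑ k, (|π k - ρ k| + ρ k * (d * δ)) := by
        refine Finset.sum_le_sum fun k _ => ?_
        rw [integral_add ((hif k).const_mul _) ((hdiff k).const_mul _), integral_const_mul,
          integral_const_mul, (HolderClass.isDensityOnCube_prod (hf k)).2, mul_one]
        gcongr
        · exact hρ k
        · exact HolderClass.integral_abs_prod_sub_prod_le (hf k) (hg k) (h k)
    _ ≤ η + d * δ := by
        rw [Finset.sum_add_distrib, ← Finset.sum_mul, hρ1, one_mul]
        gcongr

lemma integrableOn_mixture {q L : ℝ} {m d : ℕ} {g : (Fin d → ℝ) → ℝ}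
    (hg : g ∈ MixtureClass L q m d) : IntegrableOn g (unitCube d) := by
  obtain ⟨π, f, -, -, hf, rfl⟩ := hg
  exact integrable_finsetSum _ fun k _ => (HolderClass.integrable_prod (hf k)).const_mul _

lemma isDensityOnCube_of_mem_mixtureClass {q L : ℝ} {m d : ℕ} {g : (Fin d → ℝ) → ℝ}
    (hg : g ∈ MixtureClass L q m d) : IsDensityOnCube g := by
  obtain ⟨π, f, hπ, hπ1, hf, rfl⟩ := hg
  refine ⟨fun x hx => Finset.sum_nonneg fun k _ => mul_nonneg (hπ k)
    ((HolderClass.isDensityOnCube_prod (hf k)).1 x hx), ?_⟩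
  rw [integral_finsetSum _ fun k _ => (HolderClass.integrable_prod (hf k)).const_mul _]
  simp_rw [integral_const_mul, (HolderClass.isDensityOnCube_prod (hf _)).2, mul_one, hπ1]

/-- A code with finitely many values on `G` yields a finite subset of `G` that represents every
value. -/
lemma exists_finite_representatives {α κ : Type*} {G : Set α} {S : Finset κ} {code : α → κ}
    (h : ∀ g ∈ G, code g ∈ S) :
    ∃ N ⊆ G, N.Finite ∧ Nat.card N ≤ S.card ∧ ∀ f ∈ G, ∃ g ∈ N, code f = code g := by
  obtain ⟨N, hNG, hN⟩ := (Set.surjOn_image code G).exists_bijOn_subset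
  have hsub : code '' N ⊆ S := by
    rintro _ ⟨g, hg, rfl⟩
    exact h g (hNG hg)
  refine ⟨N, hNG, Set.Finite.of_finite_image (S.finite_toSet.subset hsub) hN.injOn, ?_, ?_⟩
  · rw [Nat.card_coe_set_eq, ← hN.injOn.ncard_image, ← Set.ncard_coe_finset]
    exact Set.ncard_le_ncard hsub
  · intro f hf
    obtain ⟨g, hg, hgf⟩ := hN.surjOn ⟨f, hf, rfl⟩
    exact ⟨g, hg, hgf.symm⟩

/-- Probability vectors of length `m` whose entries agree after rounding down to multiples of
`1 / (M m)` are at `ℓ¹` distance at most `1 / M`. -/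
lemma sum_abs_sub_le_of_floor_eq {m M : ℕ} (hm : 1 ≤ m) (hM : 1 ≤ M) {π ρ : Fin m → ℝ}
    (hπ : ∀ k, 0 ≤ π k) (hρ : ∀ k, 0 ≤ ρ k)
    (h : ∀ k, ⌊π k * (M * m : ℕ)⌋₊ = ⌊ρ k * (M * m : ℕ)⌋₊) :
    ∑ k, |π k - ρ k| ≤ 1 / M := by
  have hm0 : (0 : ℝ) < m := by exact_mod_cast hm
  have hM0 : (0 : ℝ) < M := by exact_mod_cast hM
  have hk : ∀ k, |π k - ρ k| ≤ 1 / (M * m) := by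
    intro k
    have hpos : (0 : ℝ) < (M * m : ℕ) := by exact_mod_cast Nat.mul_pos hM hm
    have h1 := Nat.floor_le (mul_nonneg (hπ k) hpos.le)
    have h2 := Nat.lt_floor_add_one (π k * (M * m : ℕ))
    have h3 := Nat.floor_le (mul_nonneg (hρ k) hpos.le)
    have h4 := Nat.lt_floor_add_one (ρ k * (M * m : ℕ))
    rw [h k] at h1 h2
    rw [le_div_iff₀ (by positivity), ← Nat.cast_mul, ← abs_of_pos hpos, ← abs_mul, sub_mul, abs_le]
    constructor <;> linarith
  refine (Finset.sum_le_sum fun k _ => hk k).trans_eq ?_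
  simp only [Finset.sum_const, Finset.card_univ, Fintype.card_fin, nsmul_eq_mul]
  field_simp

lemma floor_mem_filter_sum_le {m K : ℕ} {π : Fin m → ℝ} (hπ : ∀ k, 0 ≤ π k)
    (hπ1 : ∑ k, π k = 1) :
    (fun k => ⌊π k * K⌋₊) ∈ (Fintype.piFinset fun _ : Fin m => Finset.range (K + 1)).filter
      fun n => ∑ k, n k ≤ K := by
  have hsum : ∑ k, ⌊π k * K⌋₊ ≤ K := by
    have : ((∑ k, ⌊π k * K⌋₊ : ℕ) : ℝ) ≤ K := by
      push_cast
      calc ∑ k, (⌊π k * K⌋₊ : ℝ) ≤ ∑ k, π k * K :=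
            Finset.sum_le_sum fun k _ => Nat.floor_le (mul_nonneg (hπ k) K.cast_nonneg)
        _ = K := by rw [← Finset.sum_mul, hπ1, one_mul]
    exact_mod_cast this
  refine Finset.mem_filter.2 ⟨Fintype.mem_piFinset.2 fun k => ?_, hsum⟩
  have := Finset.single_le_sum (f := fun k => ⌊π k * K⌋₊) (fun _ _ => Nat.zero_le _)
    (Finset.mem_univ k)
  exact Finset.mem_range.2 (Nat.lt_succ_of_le (this.trans hsum))

lemma exp_one_mul_ceil_add_one_le {q ε : ℝ} (hq : 0 < q) (hε : 0 < ε) (hε1 : ε < 1) :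
    Real.exp 1 * (⌈2 / ε ^ 2⌉₊ + 1) ≤ Real.exp ((4 + q) * (1 / ε) ^ (2 / q)) := by
  set T : ℝ := (1 / ε) ^ (2 / q) with hT
  have hT1 : 1 ≤ T := Real.one_le_rpow ((one_le_div hε).2 hε1.le) (by positivity)
  have hTq : 1 / ε ^ 2 ≤ Real.exp (q * T) := by
    have h1 : T ^ q = 1 / ε ^ 2 := by
      rw [hT, ← Real.rpow_mul (by positivity), div_mul_cancel₀ _ hq.ne', Real.rpow_two, one_div_pow]
    rw [← h1, Real.rpow_def_of_pos (by positivity), mul_comm q]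
    have := Real.log_le_self (zero_le_one.trans hT1)
    gcongr
  have h1 := (Nat.ceil_lt_add_one (a := 2 / ε ^ 2) (by positivity)).le
  have h2 : 1 ≤ 1 / ε ^ 2 := (one_le_div (by positivity)).2 (pow_le_one₀ hε.le hε1.le)
  have h3 : (⌈2 / ε ^ 2⌉₊ : ℝ) + 1 ≤ 4 * (1 / ε ^ 2) := by
    have : 2 / ε ^ 2 = 2 * (1 / ε ^ 2) := by ring
    linarith
  have h4 : (4 : ℝ) ≤ Real.exp 3 := by
    have := Real.add_one_le_exp (3 : ℝ)
    linarith
  calc Real.exp 1 * (⌈2 / ε ^ 2⌉₊ + 1) ≤ Real.exp 1 * (Real.exp 3 * Real.exp (q * T)) := by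
        refine mul_le_mul_of_nonneg_left (h3.trans ?_) (Real.exp_pos _).le
        gcongr
    _ = Real.exp (4 + q * T) := by
        rw [← Real.exp_add, ← Real.exp_add]
        ring_nf
    _ ≤ _ := by
        gcongr
        linarith

/-- **Hellinger covering entropy of the mixture class (Lemma C.1, upper bound).** There is
`C = C(L,q)` such that for all `m, d ≥ 1` and `ε ∈ (0,1)` the class `G^{(m,d)}_{F_{L,q}}`
admits an `ε`-net of probability densities on `[0,1]^d` of log-cardinality at most
`C m d^{1+1/q} (1/ε)^{2/q}` in Hellinger distance. -/
theorem covering_entropy_hellinger (q L : ℝ) (hq : 0 < q) (hL : 0 < L) :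
    ∃ C : ℝ, 0 < C ∧
      ∀ m d : ℕ, 1 ≤ m → 1 ≤ d → ∀ ε : ℝ, 0 < ε → ε < 1 →
        ∃ N : Set ((Fin d → ℝ) → ℝ), N.Finite ∧
          (∀ g ∈ N, IsDensityOnCube g) ∧
          Real.log (Nat.card N) ≤
            C * m * (d : ℝ) ^ (1 + 1 / q) * (1 / ε) ^ (2 / q) ∧
          ∀ f ∈ MixtureClass L q m d, ∃ g ∈ N, hellingerDist f g ≤ ε := by
  obtain ⟨C, hC, hcode⟩ := HolderClass.exists_code hq hL
  refine ⟨4 + q + C * 2 ^ (1 / q), by positivity, fun m d hm hd ε hε hε1 => ?_⟩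
  have hd0 : (0 : ℝ) < d := by exact_mod_cast hd
  have hd1 : (1 : ℝ) ≤ d := by exact_mod_cast hd
  have hεsq : ε ^ 2 ≤ 1 := pow_le_one₀ hε.le hε1.le
  set T : ℝ := (1 / ε) ^ (2 / q) with hT
  have hT0 : 0 < T := by positivity
  obtain ⟨ι, S, code, hcard, hmem, hclose⟩ := hcode (ε ^ 2 / (2 * d)) (by positivity)
    (by rw [div_le_one (by positivity)]; linarith)
  set M : ℕ := ⌈2 / ε ^ 2⌉₊ with hMdef
  have hM : 1 ≤ M := Nat.ceil_pos.2 (by positivity)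
  have hM0 : (0 : ℝ) < M := by exact_mod_cast hM
  have hparam : ∀ g ∈ MixtureClass L q m d, ∃ (π : Fin m → ℝ) (f : Fin m → Fin d → ℝ → ℝ),
      (∀ k, 0 ≤ π k) ∧ (∑ k, π k = 1) ∧ (∀ k j, f k j ∈ HolderClass L q) ∧
      g = fun x => ∑ k, π k * ∏ j, f k j (x j) := fun g hg => hg
  choose! π f hπ hπ1 hf heq using hparam
  let W : Finset (Fin m → ℕ) := (Fintype.piFinset fun _ : Fin m => Finset.range (M * m + 1)).filter
    fun n => ∑ k, n k ≤ M * m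
  let P : Finset (Fin m → Fin d → ι) := Fintype.piFinset fun _ => Fintype.piFinset fun _ => S
  obtain ⟨N, hNG, hNfin, hNcard, hN⟩ := exists_finite_representatives
    (G := MixtureClass L q m d) (S := W ×ˢ P)
    (code := fun g => (fun k => ⌊π g k * (M * m : ℕ)⌋₊, fun k j => code (f g k j)))
    fun g hg => Finset.mem_product.2 ⟨floor_mem_filter_sum_le (hπ g hg) (hπ1 g hg),
      Fintype.mem_piFinset.2 fun k => Fintype.mem_piFinset.2 fun j => hmem _ (hf g hg k j)⟩
  refine ⟨N, hNfin, fun g hg => isDensityOnCube_of_mem_mixtureClass (hNG hg), ?_, ?_⟩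
  · have hScard : (S.card : ℝ) ≤ Real.exp (C * (2 ^ (1 / q) * (d : ℝ) ^ (1 / q) * T)) := by
      refine hcard.trans_eq ?_
      have h1 : 1 / (ε ^ 2 / (2 * d)) = 2 * d * (1 / ε) ^ (2 : ℝ) := by
        rw [Real.rpow_two]
        field_simp
      rw [h1, Real.mul_rpow (by positivity) (by positivity),
        Real.mul_rpow (by positivity) (by positivity), ← Real.rpow_mul (by positivity),
        mul_one_div]
    have hle : (Nat.card N : ℝ) ≤
        Real.exp ((4 + q + C * 2 ^ (1 / q)) * m * (d : ℝ) ^ (1 + 1 / q) * T) := by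
      calc (Nat.card N : ℝ) ≤ ((W ×ˢ P).card : ℝ) := by exact_mod_cast hNcard
        _ = W.card * ((S.card : ℝ) ^ d) ^ m := by
            simp [P, Finset.card_product]
        _ ≤ Real.exp ((4 + q) * T) ^ m *
            (Real.exp (C * (2 ^ (1 / q) * (d : ℝ) ^ (1 / q) * T)) ^ d) ^ m := by
            have hW : (W.card : ℝ) ≤ Real.exp ((4 + q) * T) ^ m :=
              (card_filter_sum_le m M hM).trans (pow_le_pow_left₀ (by positivity)
                (exp_one_mul_ceil_add_one_le hq hε hε1) m)
            gcongr
        _ = Real.exp ((4 + q) * (m * 1 * T) +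
            C * 2 ^ (1 / q) * (m * (d : ℝ) ^ (1 + 1 / q) * T)) := by
            rw [← Real.exp_nat_mul, ← Real.exp_nat_mul, ← Real.exp_nat_mul, ← Real.exp_add,
              Real.rpow_add hd0, Real.rpow_one]
            ring_nf
        _ ≤ Real.exp ((4 + q) * (m * (d : ℝ) ^ (1 + 1 / q) * T) +
            C * 2 ^ (1 / q) * (m * (d : ℝ) ^ (1 + 1 / q) * T)) := by
            have := Real.one_le_rpow hd1 (by positivity : 0 ≤ 1 + 1 / q)
            gcongr
        _ = _ := by ring_nf
    rcases Nat.eq_zero_or_pos (Nat.card N) with h0 | h0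
    · rw [h0, Nat.cast_zero, Real.log_zero]
      positivity
    · exact (Real.log_le_iff_le_exp (by exact_mod_cast h0)).2 hle
  · intro p hp
    obtain ⟨g, hgN, hpg⟩ := hN p hp
    have hg := hNG hgN
    refine ⟨g, hgN, ?_⟩
    rw [Prod.mk.injEq] at hpg
    refine (hellingerDist_le_sqrt_integral_abs (isDensityOnCube_of_mem_mixtureClass hp).1
      (isDensityOnCube_of_mem_mixtureClass hg).1
      ((integrableOn_mixture hp).sub (integrableOn_mixture hg)).abs).trans ?_
    refine Real.sqrt_le_iff.2 ⟨hε.le, ?_⟩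
    have hw : ∑ k, |π p k - π g k| ≤ ε ^ 2 / 2 := by
      refine (sum_abs_sub_le_of_floor_eq hm hM (hπ p hp) (hπ g hg) (congrFun hpg.1)).trans ?_
      have : 2 / ε ^ 2 ≤ M := Nat.le_ceil _
      rw [div_le_iff₀ (by positivity)] at this
      rw [div_le_iff₀ hM0]
      linarith
    have h := integral_abs_mixture_sub_le (hπ g hg) (hπ1 g hg) (hf p hp) (hf g hg) hw
      fun k j => hclose _ (hf p hp k j) _ (hf g hg k j) (congrFun (congrFun hpg.2 k) j)
    rw [heq p hp, heq g hg]
    refine h.trans_eq ?_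
    field_simp
    ring
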